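/- Let r ≥ 2 and t ≥ 1 be integers and let p be a real number with 1 ≤ p < ∞. Then the strict asymptotic density of the set of t-visible elements of ℤ^r with respect to the ℓ_p-norm equals its density with respect to the sup-norm, namely lim_{n→∞} #{z ∈ ℤ^r : ‖z‖_p ≤ n and gcd(z) = t} / #{z ∈ ℤ^r : ‖z‖_p ≤ n} = 1/(t^r ζ(r)). -/

import Mathlib

open Filter

/-- The Riemann zeta function at a natural number argument, ζ(r) = Σ_{m≥1} m^{-r}. -/
noncomputable def zetaR (r : ℕ) : ℝ := ∑' m : ℕ, 1 / ((m : ℝ) + 1) ^ r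

/-- The ℓ_p norm of an integer vector, for a real exponent `p` (with `1 ≤ p < ∞`). -/
noncomputable def lpNorm (p : ℝ) {r : ℕ} (z : Fin r → ℤ) : ℝ :=
  (∑ i, |((z i : ℤ) : ℝ)| ^ p) ^ (1 / p)

open scoped ArithmeticFunction.Moebius Pointwise Topology
open WithLp

theorem lpNorm_eq_norm_toLp {p : ℝ} (hp : 1 ≤ p) {r : ℕ} (z : Fin r → ℤ) :
    lpNorm p z = ‖toLp (ENNReal.ofReal p) (fun i ↦ (z i : ℝ))‖ := by
  have h₀ : (ENNReal.ofReal p).toReal = p := ENNReal.toReal_ofReal (by linarith)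
  simp [lpNorm, PiLp.norm_eq_sum (f := toLp (ENNReal.ofReal p) fun i ↦ (z i : ℝ))
    (h₀.symm ▸ (by linarith)), h₀]

theorem fact_one_le_ofReal {p : ℝ} (hp : 1 ≤ p) : Fact (1 ≤ ENNReal.ofReal p) :=
  ⟨ENNReal.ofReal_one ▸ ENNReal.ofReal_le_ofReal hp⟩

theorem abs_le_lpNorm {p : ℝ} (hp : 1 ≤ p) {r : ℕ} (z : Fin r → ℤ) (i : Fin r) :
    |(z i : ℝ)| ≤ lpNorm p z := by
  have := fact_one_le_ofReal hp
  rw [lpNorm_eq_norm_toLp hp]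
  simpa using PiLp.norm_apply_le (toLp (ENNReal.ofReal p) fun i ↦ (z i : ℝ)) i

theorem lpNorm_nsmul {p : ℝ} (hp : 1 ≤ p) {r : ℕ} (m : ℕ) (z : Fin r → ℤ) :
    lpNorm p (m • z) = m * lpNorm p z := by
  have := fact_one_le_ofReal hp
  rw [lpNorm_eq_norm_toLp hp, lpNorm_eq_norm_toLp hp]
  have : (fun i ↦ (((m • z) i : ℤ) : ℝ)) = (m : ℝ) • fun i ↦ (z i : ℝ) := by
    ext i; simp
  rw [this, toLp_smul, norm_smul]
  simp

theorem lpNorm_zero {p : ℝ} (hp : 1 ≤ p) {r : ℕ} : lpNorm p (0 : Fin r → ℤ) = 0 := by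
  simpa using lpNorm_nsmul hp 0 (0 : Fin r → ℤ)

theorem one_le_lpNorm {p : ℝ} (hp : 1 ≤ p) {r : ℕ} {z : Fin r → ℤ} (hz : z ≠ 0) :
    1 ≤ lpNorm p z := by
  obtain ⟨i, hi⟩ := Function.ne_iff.mp hz
  refine le_trans ?_ (abs_le_lpNorm hp z i)
  exact_mod_cast Int.one_le_abs hi

theorem setOf_lpNorm_le_subset {p : ℝ} (hp : 1 ≤ p) (r : ℕ) (y : ℝ) :
    {z : Fin r → ℤ | lpNorm p z ≤ y} ⊆
      (Fintype.piFinset fun _ : Fin r ↦ Finset.Icc (-(⌊y⌋₊ : ℤ)) ⌊y⌋₊ : Finset (Fin r → ℤ)) := by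
  intro z hz
  simp only [Finset.mem_coe, Fintype.mem_piFinset, Finset.mem_Icc, ← abs_le]
  intro i
  have h : ((z i).natAbs : ℝ) ≤ y := by
    rw [Nat.cast_natAbs, Int.cast_abs]
    exact (abs_le_lpNorm hp z i).trans hz
  rw [Int.abs_eq_natAbs]
  exact_mod_cast Nat.le_floor h

theorem finite_setOf_lpNorm_le {p : ℝ} (hp : 1 ≤ p) (r : ℕ) (y : ℝ) :
    {z : Fin r → ℤ | lpNorm p z ≤ y}.Finite :=
  (Finset.finite_toSet _).subset (setOf_lpNorm_le_subset hp r y)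

/-- The number of nonzero integer vectors of `ℓ_p`-norm at most `y`. -/
noncomputable def puncturedCount (p : ℝ) (r : ℕ) (y : ℝ) : ℕ :=
  {z : Fin r → ℤ | z ≠ 0 ∧ lpNorm p z ≤ y}.ncard

theorem puncturedCount_eq_zero {p : ℝ} (hp : 1 ≤ p) (r : ℕ) {y : ℝ} (hy : y < 1) :
    puncturedCount p r y = 0 := by
  rw [puncturedCount, Set.ncard_eq_zero ((finite_setOf_lpNorm_le hp r y).subset fun _ h ↦ h.2)]
  ext z
  simp only [Set.mem_ofPred_eq, Set.mem_empty_iff_false, iff_false, not_and, not_le]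
  exact fun hz ↦ hy.trans_le (one_le_lpNorm hp hz)

theorem ncard_lpNorm_le_eq {p : ℝ} (hp : 1 ≤ p) (r : ℕ) {y : ℝ} (hy : 0 ≤ y) :
    {z : Fin r → ℤ | lpNorm p z ≤ y}.ncard = puncturedCount p r y + 1 := by
  rw [puncturedCount, ← Set.ncard_sdiff_singleton_add_one (a := (0 : Fin r → ℤ)) _
    (finite_setOf_lpNorm_le hp r y)]
  · congr 2
    ext z
    simp [and_comm]
  · simpa [lpNorm_zero hp] using hy

theorem puncturedCount_le {p : ℝ} (hp : 1 ≤ p) (r : ℕ) {y : ℝ} (hy : 0 ≤ y) :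
    (puncturedCount p r y : ℝ) ≤ (3 * y) ^ r := by
  rcases lt_or_ge y 1 with h | h
  · rw [puncturedCount_eq_zero hp r h, Nat.cast_zero]
    positivity
  · have h_card : puncturedCount p r y ≤ (2 * ⌊y⌋₊ + 1) ^ r := by
      refine (Set.ncard_le_ncard (fun z hz ↦ setOf_lpNorm_le_subset hp r y hz.2)
        (Finset.finite_toSet _)).trans ?_
      rw [Set.ncard_coe_finset, Fintype.card_piFinset]
      simp only [Int.card_Icc, Finset.prod_const, Finset.card_univ, Fintype.card_fin]
      gcongr
      omega
    calc (puncturedCount p r y : ℝ) ≤ ((2 * ⌊y⌋₊ + 1) ^ r : ℕ) := mod_cast h_card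
      _ ≤ (3 * y) ^ r := by
        push_cast
        gcongr
        linarith [Nat.floor_le hy]

theorem exists_tendsto_ncard_lpNorm_le_div_pow {p : ℝ} (hp : 1 ≤ p) (r : ℕ) :
    ∃ c : ℝ, 0 < c ∧ Tendsto
      (fun y : ℝ ↦ ({z : Fin r → ℤ | lpNorm p z ≤ y}.ncard : ℝ) / y ^ r) atTop (𝓝 c) := by
  have := fact_one_le_ofReal hp
  let s : Set (Fin r → ℝ) := {x | ‖toLp (ENNReal.ofReal p) x‖ ≤ 1}
  have hcont : Continuous fun x : Fin r → ℝ ↦ ‖toLp (ENNReal.ofReal p) x‖ :=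
    (PiLp.continuous_toLp _ _).norm
  have hclosed : IsClosed s := isClosed_le hcont continuous_const
  have hbdd : Bornology.IsBounded s := by
    refine (Metric.isBounded_closedBall (x := 0) (r := 1)).subset fun x hx ↦ ?_
    rw [mem_closedBall_zero_iff, pi_norm_le_iff_of_nonneg zero_le_one]
    exact fun i ↦ (PiLp.norm_apply_le (toLp (ENNReal.ofReal p) x) i).trans hx
  have hconv : Convex ℝ s := by
    have h := (convex_closedBall (0 : PiLp (ENNReal.ofReal p) fun _ : Fin r ↦ ℝ) 1).linear_preimage
      (WithLp.linearEquiv (ENNReal.ofReal p) ℝ (Fin r → ℝ)).symm.toLinearMap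
    have hs : s = (WithLp.linearEquiv (ENNReal.ofReal p) ℝ (Fin r → ℝ)).symm.toLinearMap ⁻¹'
        Metric.closedBall 0 1 := by
      ext x
      simp [s]
    rw [hs]
    exact h
  have hmono : ∀ ⦃x y : ℝ⦄, 0 < x → x ≤ y → x • s ⊆ y • s := by
    intro x y hx hxy
    have hy := hx.trans_le hxy
    rintro _ ⟨v, hv, rfl⟩
    refine ⟨(y⁻¹ * x) • v, ?_, by simp [smul_smul, hy.ne']⟩
    have hv : ‖toLp (ENNReal.ofReal p) v‖ ≤ 1 := hv
    change ‖toLp (ENNReal.ofReal p) ((y⁻¹ * x) • v)‖ ≤ 1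
    rw [toLp_smul, norm_smul, Real.norm_of_nonneg (by positivity)]
    refine mul_le_one₀ ?_ (norm_nonneg _) hv
    rwa [inv_mul_le_one₀ hy]
  have hpos : 0 < MeasureTheory.volume.real s := by
    refine ENNReal.toReal_pos ?_ hbdd.measure_lt_top.ne
    refine ne_of_gt (lt_of_lt_of_le ?_ (MeasureTheory.measure_mono
      (fun x (hx : ‖toLp (ENNReal.ofReal p) x‖ < 1) ↦ hx.le : {x | _} ⊆ s)))
    exact (isOpen_lt hcont continuous_const).measure_pos _ ⟨0, by simp⟩
  refine ⟨_, hpos, ?_⟩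
  refine (tendsto_card_div_pow_atTop_volume' s hbdd hclosed.measurableSet
    (hconv.addHaar_frontier _) hmono).congr' ?_
  filter_upwards [eventually_gt_atTop 0] with y hy
  rw [Fintype.card_fin, Nat.card_coe_set_eq]
  congr 2
  symm
  refine Set.ncard_congr (fun z _ ↦ y⁻¹ • fun i ↦ (z i : ℝ)) ?_ ?_ ?_
  · intro z hz
    refine ⟨?_, Set.smul_mem_smul_set ?_⟩
    · change ‖toLp (ENNReal.ofReal p) (y⁻¹ • fun i ↦ (z i : ℝ))‖ ≤ 1
      rw [toLp_smul, norm_smul, Real.norm_of_nonneg (by positivity), ← lpNorm_eq_norm_toLp hp,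
        inv_mul_le_one₀ hy]
      exact hz
    · rw [SetLike.mem_coe, Module.Basis.mem_span_iff_repr_mem]
      simp
  · intro z w _ _ h
    have h := smul_right_injective _ (inv_ne_zero hy.ne') h
    ext i
    exact_mod_cast congrFun h i
  · rintro x ⟨hx, v, hv, rfl⟩
    rw [SetLike.mem_coe, Module.Basis.mem_span_iff_repr_mem] at hv
    choose z hz using hv
    have hzv : (fun i ↦ (z i : ℝ)) = v := by
      ext i
      simpa using hz i
    refine ⟨z, ?_, by simp [hzv]⟩
    have hx : ‖toLp (ENNReal.ofReal p) (y⁻¹ • v)‖ ≤ 1 := hx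
    rw [toLp_smul, norm_smul, Real.norm_of_nonneg (by positivity), ← hzv,
      ← lpNorm_eq_norm_toLp hp, inv_mul_le_one₀ hy] at hx
    exact hx

theorem exists_tendsto_puncturedCount_div_pow {p : ℝ} (hp : 1 ≤ p) {r : ℕ} (hr : r ≠ 0) :
    ∃ c : ℝ, 0 < c ∧ Tendsto
      (fun y : ℝ ↦ ({z : Fin r → ℤ | lpNorm p z ≤ y}.ncard : ℝ) / y ^ r) atTop (𝓝 c) ∧
      Tendsto (fun y : ℝ ↦ (puncturedCount p r y : ℝ) / y ^ r) atTop (𝓝 c) := by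
  obtain ⟨c, hc, h⟩ := exists_tendsto_ncard_lpNorm_le_div_pow hp r
  refine ⟨c, hc, h, ?_⟩
  have h₀ : Tendsto (fun y : ℝ ↦ 1 / y ^ r) atTop (𝓝 0) := by
    simpa using! (tendsto_pow_atTop hr).inv_tendsto_atTop (𝕜 := ℝ)
  rw [← sub_zero c]
  refine (h.sub h₀).congr' ?_
  filter_upwards [eventually_ge_atTop 0] with y hy
  rw [ncard_lpNorm_le_eq hp r hy]
  push_cast
  ring

theorem tsum_moebius_div_pow {r : ℕ} (hr : 2 ≤ r) :
    ∑' k : ℕ, (μ k : ℝ) / (k : ℝ) ^ r = 1 / zetaR r := by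
  have hr' : 1 < (r : ℂ).re := by simpa using show 1 < r by omega
  have h := ArithmeticFunction.LSeries_zeta_mul_Lseries_moebius hr'
  have hz : riemannZeta r = (zetaR r : ℂ) := by
    have h_real : ∑' n : ℕ, 1 / (n : ℝ) ^ r = zetaR r := by
      rw [zetaR, (Real.summable_one_div_nat_pow.mpr (by omega)).tsum_eq_zero_add]
      simp [show r ≠ 0 by omega]
    rw [zeta_nat_eq_tsum_of_gt_one (by omega), ← h_real, Complex.ofReal_tsum]
    simp
  have hm : LSeries (fun n ↦ (μ n : ℂ)) r = ((∑' k : ℕ, (μ k : ℝ) / (k : ℝ) ^ r : ℝ) : ℂ) := by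
    rw [LSeries, Complex.ofReal_tsum]
    refine tsum_congr fun k ↦ ?_
    rcases eq_or_ne k 0 with rfl | hk
    · simp
    · simp [LSeries.term_of_ne_zero hk]
  rw [ArithmeticFunction.LSeries_zeta_eq_riemannZeta hr', hz, hm] at h
  have h : zetaR r * ∑' k : ℕ, (μ k : ℝ) / (k : ℝ) ^ r = 1 := mod_cast h
  rw [eq_div_iff (left_ne_zero_of_mul_eq_one h), mul_comm, h]

theorem sum_divisors_moebius (m : ℕ) :
    ∑ d ∈ m.divisors, μ d = if m = 1 then 1 else 0 := by
  rw [← ArithmeticFunction.coe_mul_zeta_apply, ArithmeticFunction.moebius_mul_coe_zeta,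
    ArithmeticFunction.one_apply]

theorem sum_moebius_of_mul_dvd {t g n : ℕ} (ht : 0 < t) (hg : 0 < g) (hgn : g ≤ n) :
    ∑ k ∈ Finset.Icc 1 n with t * k ∣ g, μ k = if g = t then 1 else 0 := by
  by_cases htg : t ∣ g
  · obtain ⟨m, rfl⟩ := htg
    have hm : 0 < m := Nat.pos_of_mul_pos_left hg
    have hmn : m ≤ n := (Nat.le_mul_of_pos_left m ht).trans hgn
    have : {k ∈ Finset.Icc 1 n | t * k ∣ t * m} = m.divisors := by
      ext k
      simp only [Finset.mem_filter, Finset.mem_Icc, Nat.mem_divisors, Nat.mul_dvd_mul_iff_left ht]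
      exact ⟨fun h ↦ ⟨h.2, hm.ne'⟩, fun h ↦
        ⟨⟨Nat.pos_of_dvd_of_pos h.1 hm, (Nat.le_of_dvd hm h.1).trans hmn⟩, h.1⟩⟩
    rw [this, sum_divisors_moebius]
    simp [ht.ne']
  · rw [Finset.filter_false_of_mem fun k _ h ↦ htg ((Nat.dvd_mul_right t k).trans h),
      Finset.sum_empty, if_neg fun h : g = t ↦ htg (h ▸ dvd_rfl)]

theorem ncard_dvd_gcd_eq_puncturedCount {p : ℝ} (hp : 1 ≤ p) (r : ℕ) {m : ℕ} (hm : 0 < m) (y : ℝ) :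
    {z : Fin r → ℤ | (z ≠ 0 ∧ lpNorm p z ≤ y) ∧ (m : ℤ) ∣ Finset.univ.gcd z}.ncard =
      puncturedCount p r (y / m) := by
  have hm' : (0 : ℝ) < m := mod_cast hm
  symm
  refine Set.ncard_congr (fun z _ ↦ m • z) ?_ ?_ ?_
  · rintro z ⟨hz, hzy⟩
    refine ⟨⟨smul_ne_zero hm.ne' hz, ?_⟩, Finset.dvd_gcd fun i _ ↦ by simp⟩
    rwa [lpNorm_nsmul hp, mul_comm, ← le_div_iff₀ hm']
  · exact fun z w _ _ h ↦ smul_right_injective _ hm.ne' h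
  · rintro z ⟨⟨hz, hzy⟩, hd⟩
    have hd := fun i ↦ (Finset.dvd_gcd_iff.mp hd) i (Finset.mem_univ i)
    choose w hw using hd
    obtain rfl : z = m • w := by
      ext i
      simpa using hw i
    refine ⟨w, ⟨right_ne_zero_of_smul hz, ?_⟩, rfl⟩
    rwa [lpNorm_nsmul hp, mul_comm, ← le_div_iff₀ hm'] at hzy

theorem ncard_gcd_eq_sum_moebius {p : ℝ} (hp : 1 ≤ p) (r : ℕ) {t : ℕ} (ht : 0 < t) (n : ℕ) :
    ({z : Fin r → ℤ | lpNorm p z ≤ (n : ℝ) ∧ Finset.univ.gcd z = (t : ℤ)}.ncard : ℤ) =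
      ∑ k ∈ Finset.Icc 1 n, μ k * puncturedCount p r ((n : ℝ) / (t * k : ℕ)) := by
  classical
  have hfin : {z : Fin r → ℤ | z ≠ 0 ∧ lpNorm p z ≤ (n : ℝ)}.Finite :=
    (finite_setOf_lpNorm_le hp r n).subset fun _ h ↦ h.2
  let B := hfin.toFinset
  have hgcd (z : Fin r → ℤ) : ((Finset.univ.gcd z).natAbs : ℤ) = Finset.univ.gcd z := by
    rw [← Int.normalize_coe_nat, Int.natCast_natAbs, ← Int.abs_eq_normalize, abs_abs,
      Int.abs_eq_normalize, Finset.normalize_gcd]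
  have h₁ : {z : Fin r → ℤ | lpNorm p z ≤ (n : ℝ) ∧ Finset.univ.gcd z = (t : ℤ)} =
      {z ∈ B | (Finset.univ.gcd z).natAbs = t} := by
    ext z
    simp only [Set.mem_ofPred_eq, Finset.coe_filter, B, Set.Finite.mem_toFinset]
    refine ⟨fun h ↦ ⟨⟨?_, h.1⟩, by simp [h.2]⟩, fun h ↦ ⟨h.1.2, by rw [← hgcd z, h.2]⟩⟩
    rintro rfl
    have h₀ : Finset.univ.gcd (0 : Fin r → ℤ) = 0 := Finset.gcd_eq_zero_iff.mpr (by simp)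
    rw [h₀] at h
    exact ht.ne (by exact_mod_cast h.2)
  have h₂ : ∀ z ∈ B, ((if (Finset.univ.gcd z).natAbs = t then 1 else 0 : ℤ)) =
      ∑ k ∈ Finset.Icc 1 n, if t * k ∣ (Finset.univ.gcd z).natAbs then μ k else 0 := by
    intro z hz
    obtain ⟨hz, hzn⟩ : z ≠ 0 ∧ lpNorm p z ≤ (n : ℝ) := by simpa [B] using hz
    obtain ⟨i, hi⟩ := Function.ne_iff.mp hz
    have hdvd : (Finset.univ.gcd z).natAbs ∣ (z i).natAbs :=
      Int.natAbs_dvd_natAbs.mpr (Finset.gcd_dvd (Finset.mem_univ i))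
    have hpos : 0 < (z i).natAbs := Int.natAbs_pos.mpr hi
    have hle : (z i).natAbs ≤ n := by
      have := (abs_le_lpNorm hp z i).trans hzn
      rw [← Int.cast_abs, ← Nat.cast_natAbs] at this
      exact_mod_cast this
    rw [← Finset.sum_filter, sum_moebius_of_mul_dvd ht (Nat.pos_of_dvd_of_pos hdvd hpos)
      ((Nat.le_of_dvd hpos hdvd).trans hle)]
  rw [h₁, Set.ncard_coe_finset, Finset.card_filter]
  simp only [Nat.cast_sum, Nat.cast_ite, Nat.cast_one, Nat.cast_zero]
  rw [Finset.sum_congr rfl h₂, Finset.sum_comm]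
  refine Finset.sum_congr rfl fun k hk ↦ ?_
  rw [← ncard_dvd_gcd_eq_puncturedCount hp r (Nat.mul_pos ht (Finset.mem_Icc.mp hk).1),
    ← Finset.sum_filter, Finset.sum_const, nsmul_eq_mul, mul_comm, ← Set.ncard_coe_finset]
  congr 3
  ext z
  rw [Finset.coe_filter, Set.mem_ofPred_eq, Set.mem_ofPred_eq, Int.natCast_dvd,
    Set.Finite.mem_toFinset]
  rfl

theorem tendsto_ncard_gcd_div_pow {p : ℝ} (hp : 1 ≤ p) {r t : ℕ} (hr : 2 ≤ r) (ht : 0 < t) {c : ℝ}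
    (hc : Tendsto (fun y : ℝ ↦ (puncturedCount p r y : ℝ) / y ^ r) atTop (𝓝 c)) :
    Tendsto (fun n : ℕ ↦
      ({z : Fin r → ℤ | lpNorm p z ≤ (n : ℝ) ∧ Finset.univ.gcd z = (t : ℤ)}.ncard : ℝ) /
        (n : ℝ) ^ r) atTop (𝓝 (c / (t : ℝ) ^ r * (1 / zetaR r))) := by
  have key : ∀ᶠ n : ℕ in atTop,
      ∑' k : ℕ, (μ k : ℝ) * (puncturedCount p r ((n : ℝ) / (t * k : ℕ)) / (n : ℝ) ^ r) =
      ({z : Fin r → ℤ | lpNorm p z ≤ (n : ℝ) ∧ Finset.univ.gcd z = (t : ℤ)}.ncard : ℝ) /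
        (n : ℝ) ^ r := by
    refine Eventually.of_forall fun n ↦ ?_
    rw [tsum_eq_sum (s := Finset.Icc 1 n)]
    · have h := congrArg (Int.cast : ℤ → ℝ) (ncard_gcd_eq_sum_moebius hp r ht n)
      push_cast at h
      rw [h, Finset.sum_div]
      exact Finset.sum_congr rfl fun k _ ↦ by push_cast; ring
    · intro k hk
      rcases Nat.eq_zero_or_pos k with rfl | hk0
      · simp
      have hnk : n < k := by
        simp only [Finset.mem_Icc, not_and, not_le] at hk
        exact hk hk0
      rw [puncturedCount_eq_zero hp r]
      · simp
      · rw [div_lt_one (by exact_mod_cast Nat.mul_pos ht hk0)]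
        exact_mod_cast hnk.trans_le (Nat.le_mul_of_pos_left k ht)
  refine Tendsto.congr' key ?_
  rw [← tsum_moebius_div_pow hr, ← tsum_mul_left]
  refine tendsto_tsum_of_dominated_convergence
    (bound := fun k : ℕ ↦ 3 ^ r * (1 / (k : ℝ) ^ r)) ?_ ?_ ?_
  · exact (Real.summable_one_div_nat_pow.mpr (by omega)).mul_left _
  · intro k
    rcases Nat.eq_zero_or_pos k with rfl | hk
    · simp
    have hm : (0 : ℝ) < (t * k : ℕ) := by exact_mod_cast Nat.mul_pos ht hk
    have h := (hc.comp (tendsto_natCast_atTop_atTop.atTop_div_const hm)).const_mul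
      ((μ k : ℝ) / ((t * k : ℕ) : ℝ) ^ r)
    have hk' : (k : ℝ) ≠ 0 := by positivity
    convert h using 2 with n
    · simp only [Function.comp_apply, div_pow]
      rcases eq_or_ne (n : ℝ) 0 with hn | hn
      · simp [hn, show r ≠ 0 by omega]
      · field_simp
    · push_cast
      rw [mul_pow]
      field_simp
  · filter_upwards [eventually_gt_atTop 0] with n hn k
    rcases Nat.eq_zero_or_pos k with rfl | hk
    · simp [show r ≠ 0 by omega]
    have hn' : (0 : ℝ) < n := mod_cast hn
    have hk' : (0 : ℝ) < k := mod_cast hk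
    have hμ : |(μ k : ℝ)| ≤ 1 := mod_cast ArithmeticFunction.abs_moebius_le_one (n := k)
    rw [norm_mul, Real.norm_eq_abs, Real.norm_of_nonneg (by positivity)]
    calc |(μ k : ℝ)| * (puncturedCount p r ((n : ℝ) / (t * k : ℕ)) / (n : ℝ) ^ r)
        ≤ 1 * ((3 * ((n : ℝ) / (t * k : ℕ))) ^ r / (n : ℝ) ^ r) := by
          gcongr
          exact puncturedCount_le hp r (by positivity)
      _ ≤ 1 * ((3 * ((n : ℝ) / k)) ^ r / (n : ℝ) ^ r) := by
          gcongr
          exact Nat.le_mul_of_pos_left k ht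
      _ = 3 ^ r * (1 / (k : ℝ) ^ r) := by
          rw [mul_pow, div_pow]
          field_simp

/-- For `1 ≤ p < ∞`, the strict asymptotic density, with respect to the ℓ_p-norm,
of the set of `t`-visible elements of `ℤ^r` equals `1 / (t^r ζ(r))`, the same value
as for the sup-norm. -/
theorem stmt_1 (r t : ℕ) (hr : 2 ≤ r) (ht : 1 ≤ t) (p : ℝ) (hp : 1 ≤ p) :
    Tendsto (fun n : ℕ =>
      (({z : Fin r → ℤ | lpNorm p z ≤ (n : ℝ) ∧ Finset.univ.gcd z = (t : ℤ)}.ncard : ℝ)) /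
        ({z : Fin r → ℤ | lpNorm p z ≤ (n : ℝ)}.ncard : ℝ))
      atTop (nhds (1 / ((t : ℝ) ^ r * zetaR r))) := by
  obtain ⟨c, hc, hD, hN⟩ := exists_tendsto_puncturedCount_div_pow hp (r := r) (by omega)
  have h := (tendsto_ncard_gcd_div_pow hp hr ht hN).div
    (hD.comp tendsto_natCast_atTop_atTop) hc.ne'
  have hlim : c / (t : ℝ) ^ r * (1 / zetaR r) / c = 1 / ((t : ℝ) ^ r * zetaR r) := by
    field_simp
  rw [← hlim]
  refine h.congr' ?_
  filter_upwards [eventually_gt_atTop 0] with n hn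
  have hn' : (n : ℝ) ^ r ≠ 0 := by positivity
  exact div_div_div_cancel_right₀ hn' _ _
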